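/- Insecurity of the O-OT gate with purely quantum communication: for c ∈ {0,1}, let out_c = G[(1/2)(|00⟩+|01⟩+|10⟩+|11⟩)_{A1A2} ⊗ |Φ+⟩_{T1T2} ⊗ |0⟩_{T3} ⊗ |c⟩_B] be the output of the O-OT gate when Alice sends the uniform superposition over her four classical inputs through a quantum channel and Bob inputs the choice c. Then the reduced density operators on Alice's registers differ: Tr_{(T2,T3,B)}|out_0⟩⟨out_0| ≠ Tr_{(T2,T3,B)}|out_1⟩⟨out_1| as operators on the three-qubit space of (A1,A2,T1). Hence Bob's choice c is not concealed from Alice. -/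

import Mathlib

open Matrix Kronecker

/-- Index type of the six-qubit state space, listing the registers
`(A1, A2, T1, T2, T3, B)`: `A1, A2` are Alice's inputs, `T1, T2, T3` the
trusted party's qubits J and `B` Bob's input. -/
abbrev Idx6 : Type := Fin 2 × Fin 2 × Fin 2 × Fin 2 × Fin 2 × Fin 2

/-- The computational basis vector `|a1 a2 t1 t2 t3 b⟩`. -/
def ket6 (a1 a2 t1 t2 t3 b : Fin 2) : Idx6 → ℂ :=
  fun x => if x = (a1, a2, t1, t2, t3, b) then 1 else 0

/-- The Pauli matrix `σ_x`. -/
def sigmaX : Matrix (Fin 2) (Fin 2) ℂ := !![0, 1; 1, 0]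

/-- The Pauli matrix `σ_z`. -/
def sigmaZ : Matrix (Fin 2) (Fin 2) ℂ := !![1, 0; 0, -1]

/-- The real matrix `iσ_y = [[0,1],[−1,0]]` (equal to `σ_y` up to a global phase). -/
def iSigmaY : Matrix (Fin 2) (Fin 2) ℂ := !![0, 1; -1, 0]

/-- The rotations `R_{b0 b1}`: `R_00 = I`, `R_01 = σ_z`, `R_10 = σ_x`, `R_11 = iσ_y`. -/
def Rot (b0 b1 : Fin 2) : Matrix (Fin 2) (Fin 2) ℂ :=
  if b0 = 0 then (if b1 = 0 then 1 else sigmaZ)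
  else (if b1 = 0 then sigmaX else iSigmaY)

/-- The single-qubit π/2 rotation about the y-axis,
`R = exp(−i(π/4)σ_y) = (1/√2)[[1,−1],[1,1]]`. -/
noncomputable def Ry : Matrix (Fin 2) (Fin 2) ℂ :=
  (1 / (Real.sqrt 2 : ℂ)) • !![1, -1; 1, 1]

/-- The bilateral π/2 rotation `B_y = R ⊗ R`. -/
noncomputable def By : Matrix (Fin 2 × Fin 2) (Fin 2 × Fin 2) ℂ := Ry ⊗ₖ Ry

/-- Gate (i) of the O-OT gate: the controlled rotation applying `R_{b0 b1}` to
`T1` when `(A1, A2)` hold the basis state `|b0 b1⟩`. -/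
def gate1 : Matrix Idx6 Idx6 ℂ :=
  fun x y =>
    (if x.1 = y.1 then 1 else 0) * (if x.2.1 = y.2.1 then 1 else 0) *
      Rot y.1 y.2.1 x.2.2.1 y.2.2.1 *
      (if x.2.2.2 = y.2.2.2 then 1 else 0)

/-- Gate (ii) of the O-OT gate: the controlled bilateral rotation applying
`B_y` to `(T1, T2)` when `B` holds `|1⟩`. -/
noncomputable def gate2 : Matrix Idx6 Idx6 ℂ :=
  fun x y =>
    (if x.1 = y.1 then 1 else 0) * (if x.2.1 = y.2.1 then 1 else 0) *
      (if x.2.2.2.2.1 = y.2.2.2.2.1 then 1 else 0) *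
      (if x.2.2.2.2.2 = y.2.2.2.2.2 then 1 else 0) *
      (if y.2.2.2.2.2 = 1 then By (x.2.2.1, x.2.2.2.1) (y.2.2.1, y.2.2.2.1)
       else (if x.2.2.1 = y.2.2.1 then 1 else 0) * (if x.2.2.2.1 = y.2.2.2.1 then 1 else 0))

/-- Gate (iii) of the O-OT gate: CNOT with control `T1` and target `T3`. -/
def gate3 : Matrix Idx6 Idx6 ℂ :=
  fun x y =>
    (if x.1 = y.1 then 1 else 0) * (if x.2.1 = y.2.1 then 1 else 0) *
      (if x.2.2.1 = y.2.2.1 then 1 else 0) * (if x.2.2.2.1 = y.2.2.2.1 then 1 else 0) *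
      (if x.2.2.2.2.1 = y.2.2.1 + y.2.2.2.2.1 then 1 else 0) *
      (if x.2.2.2.2.2 = y.2.2.2.2.2 then 1 else 0)

/-- The O-OT gate `G`: first the controlled rotation, then the controlled
bilateral rotation, then the CNOT. -/
noncomputable def ootGate : Matrix Idx6 Idx6 ℂ := gate3 * gate2 * gate1

/-- The input state `(1/2)(|00⟩+|01⟩+|10⟩+|11⟩)_{A1A2} ⊗ |Φ+⟩_{T1T2} ⊗ |0⟩_{T3} ⊗ |c⟩_B`,
written out as `(1/(2√2)) Σ_{a1 a2} (|a1 a2 0 0 0 c⟩ + |a1 a2 1 1 0 c⟩)`. -/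
noncomputable def inState (c : Fin 2) : Idx6 → ℂ :=
  (1 / (2 * (Real.sqrt 2 : ℂ))) •
    (ket6 0 0 0 0 0 c + ket6 0 1 0 0 0 c + ket6 1 0 0 0 0 c + ket6 1 1 0 0 0 c +
     ket6 0 0 1 1 0 c + ket6 0 1 1 1 0 c + ket6 1 0 1 1 0 c + ket6 1 1 1 1 0 c)

/-- The rank-one projection `|ψ⟩⟨ψ|` onto the span of a vector `ψ`. -/
noncomputable def outerProj (ψ : Idx6 → ℂ) : Matrix Idx6 Idx6 ℂ :=
  fun x y => ψ x * star (ψ y)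

/-- The partial trace over Bob's registers `(T2, T3, B)`, yielding an operator
on Alice's three-qubit space `(A1, A2, T1)`. -/
noncomputable def ptraceBob (ρ : Matrix Idx6 Idx6 ℂ) :
    Matrix (Fin 2 × Fin 2 × Fin 2) (Fin 2 × Fin 2 × Fin 2) ℂ :=
  fun u u' => ∑ t2 : Fin 2, ∑ t3 : Fin 2, ∑ b : Fin 2,
    ρ (u.1, u.2.1, u.2.2, t2, t3, b) (u'.1, u'.2.1, u'.2.2, t2, t3, b)

theorem gate1_mulVec (ψ : Idx6 → ℂ) (a1 a2 t1 t2 t3 b : Fin 2) :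
    gate1.mulVec ψ (a1, a2, t1, t2, t3, b) =
      ∑ s : Fin 2, Rot a1 a2 t1 s * ψ (a1, a2, s, t2, t3, b) := by
  simp [Matrix.mulVec, dotProduct, gate1, Fintype.sum_prod_type, ite_and, Prod.ext_iff]

theorem gate2_mulVec (ψ : Idx6 → ℂ) (a1 a2 t1 t2 t3 b : Fin 2) :
    gate2.mulVec ψ (a1, a2, t1, t2, t3, b) =
      if b = 1 then
        ∑ s1 : Fin 2, ∑ s2 : Fin 2, By (t1, t2) (s1, s2) * ψ (a1, a2, s1, s2, t3, b)
      else ψ (a1, a2, t1, t2, t3, b) := by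
  fin_cases b <;>
    fin_cases t1 <;> fin_cases t2 <;> fin_cases t3 <;>
    simp [Matrix.mulVec, dotProduct, gate2, Fintype.sum_prod_type]

theorem gate3_mulVec (ψ : Idx6 → ℂ) (a1 a2 t1 t2 t3 b : Fin 2) :
    gate3.mulVec ψ (a1, a2, t1, t2, t3, b) = ψ (a1, a2, t1, t2, t3 - t1, b) := by
  simp [Matrix.mulVec, dotProduct, gate3, Fintype.sum_prod_type, ← sub_eq_iff_eq_add']

theorem inState_apply (c a1 a2 t1 t2 t3 b : Fin 2) :
    inState c (a1, a2, t1, t2, t3, b) =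
      if t1 = t2 ∧ t3 = 0 ∧ b = c then 1 / (2 * (Real.sqrt 2 : ℂ)) else 0 := by
  fin_cases a1 <;> fin_cases a2 <;> fin_cases t1 <;> fin_cases t2 <;>
    simp [inState, ket6, ite_and]

theorem ootGate_mulVec (ψ : Idx6 → ℂ) :
    ootGate.mulVec ψ = gate3.mulVec (gate2.mulVec (gate1.mulVec ψ)) := by
  simp [ootGate, Matrix.mulVec_mulVec, Matrix.mul_assoc]

/-- The coherence `⟨000| · |010⟩` of Alice's reduced state vanishes for `c = 1`. -/
theorem ptraceBob_coherence_one :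
    ptraceBob (outerProj (ootGate.mulVec (inState 1))) (0, 0, 0) (0, 1, 0) = 0 := by
  simp [-Matrix.mulVec_mulVec, ptraceBob, outerProj, ootGate_mulVec, gate1_mulVec, gate2_mulVec, gate3_mulVec,
    inState_apply, Rot, sigmaZ, By, Ry, Fin.sum_univ_two]

/-- The coherence `⟨000| · |010⟩` of Alice's reduced state does not vanish for `c = 0`. -/
theorem ptraceBob_coherence_zero :
    ptraceBob (outerProj (ootGate.mulVec (inState 0))) (0, 0, 0) (0, 1, 0) ≠ 0 := by
  simp [-Matrix.mulVec_mulVec, ptraceBob, outerProj, ootGate_mulVec, gate1_mulVec, gate2_mulVec, gate3_mulVec,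
    inState_apply, Rot, sigmaZ, Fin.sum_univ_two]

/-- **Insecurity of the O-OT gate with purely quantum communication:** when
Alice sends the uniform superposition over her four classical inputs through a
quantum channel, the reduced density operators on Alice's registers
`(A1, A2, T1)` differ for Bob's choices `c = 0` and `c = 1`; hence Bob's choice
is not concealed from Alice. -/
theorem ootGate_quantum_channel_insecure :
    ptraceBob (outerProj (ootGate.mulVec (inState 0))) ≠
      ptraceBob (outerProj (ootGate.mulVec (inState 1))) := by
  intro h
  exact ptraceBob_coherence_zero (by rw [h, ptraceBob_coherence_one])
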